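/- arXiv:1708.04071 — 2 statements merged into one kernel-verified Lean document; each statement's English description precedes it below -/
import Mathlib

section
/- Let n ≥ 6 and q ≥ 4 be integers, and let t = ⌈log₂ n⌉. Then for every a with 0 ≤ a ≤ n−1 and every b ∈ Z_q, the rate (1/n)·log₂|VT_{a,b}(n)| of the q-ary Varshamov–Tenengolts code VT_{a,b}(n) is at least log₂ q − (t/n)·(3·log₂ q − 2·log₂(q−1)) − (1/n)·(5·log₂(q−1) − 3·log₂ q). -/
/-- VT syndrome of the auxiliary binary sequence of a q-ary sequence `s_0 ⋯ s_{n-1}`: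
the auxiliary bit `α_i` (1 ≤ i ≤ n-1) is 1 iff `s_i ≥ s_{i-1}`, and
`syn(A_S) = (∑ i, i · α_i) mod n`. -/
def qsyn {n q : ℕ} (S : Fin n → Fin q) : ℕ :=
  (∑ i : Fin (n - 1), (i.val + 1) *
    (if S ⟨i.val, by have := i.isLt; omega⟩ ≤ S ⟨i.val + 1, by have := i.isLt; omega⟩
      then 1 else 0)) % n

/-- Modular sum of a q-ary sequence: `sum(S) = (∑ i, s_i) mod q`. -/
def qsum {n q : ℕ} (S : Fin n → Fin q) : ℕ :=
  (∑ i : Fin n, (S i).val) % q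

/-- The q-ary VT code `VT_{a,b}(n)`. -/
def VTq (n q : ℕ) (a b : ℕ) : Finset (Fin n → Fin q) :=
  Finset.univ.filter fun S => qsyn S = a ∧ qsum S = b

open Finset in
theorem sum_two_pow_mul_bit (N t : ℕ) :
    ∑ j ∈ range t, 2 ^ j * (N / 2 ^ j % 2) = N % 2 ^ t := by
  induction t with
  | zero => simp [Nat.mod_one]
  | succ t ih => rw [sum_range_succ, ih, Nat.mod_pow_succ]

/-- Three symbols of an alphabet of size at least 4 can realise any two prescribed comparisons
and any prescribed sum modulo `q`. -/
theorem exists_triple (q : ℕ) (hq : 4 ≤ q) (P Q : Prop) (c : ℕ) :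
    ∃ u v w, u < q ∧ v < q ∧ w < q ∧ (u ≤ v ↔ P) ∧ (v ≤ w ↔ Q) ∧ (u + v + w) % q = c % q := by
  have hc : c % q < q := Nat.mod_lt _ (by omega)
  generalize c % q = d at hc
  have wrap : ∀ s, s = d ∨ s = d + q → s % q = d := by
    rintro s (rfl | rfl)
    · exact Nat.mod_eq_of_lt hc
    · rw [Nat.add_mod_right, Nat.mod_eq_of_lt hc]
  by_cases hP : P <;> by_cases hQ : Q <;> simp only [hP, hQ, iff_true, iff_false]
  · exact ⟨0, 0, d, by omega, by omega, hc, by omega, by omega, wrap _ (by omega)⟩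
  · by_cases h0 : d = 0
    · exact ⟨1, q - 1, 0, by omega, by omega, by omega, by omega, by omega, wrap _ (by omega)⟩
    · exact ⟨0, d, 0, by omega, by omega, by omega, by omega, by omega, wrap _ (by omega)⟩
  · by_cases h0 : d = 0
    · exact ⟨1, 0, q - 1, by omega, by omega, by omega, by omega, by omega, wrap _ (by omega)⟩
    · exact ⟨d, 0, 0, by omega, by omega, by omega, by omega, by omega, wrap _ (by omega)⟩
  · by_cases h3 : 3 ≤ d
    · exact ⟨d - 1, 1, 0, by omega, by omega, by omega, by omega, by omega, wrap _ (by omega)⟩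
    by_cases h2 : d = 2
    · by_cases h4 : q = 4
      · exact ⟨3, 2, 1, by omega, by omega, by omega, by omega, by omega, wrap _ (by omega)⟩
      · exact ⟨q - 1, 3, 0, by omega, by omega, by omega, by omega, by omega, wrap _ (by omega)⟩
    · exact ⟨q - 1, d + 1, 0, by omega, by omega, by omega, by omega, by omega, wrap _ (by omega)⟩

theorem exists_add_mod_eq (n a C : ℕ) (ha : a < n) : ∃ N < n, (N + C) % n = a := by
  refine ⟨(a + (n - C % n)) % n, Nat.mod_lt _ (by omega), ?_⟩
  have hC : C % n < n := Nat.mod_lt _ (by omega)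
  rw [Nat.add_mod, Nat.mod_mod, ← Nat.add_mod_mod, Nat.mod_mod, Nat.mod_add_mod,
    show a + (n - C % n) + C % n = a + n by omega, Nat.add_mod_right, Nat.mod_eq_of_lt ha]

/-- The powers of two that are at least 4. -/
def IsDyadic (i : ℕ) : Prop := ∃ j, 2 ≤ j ∧ i = 2 ^ j

theorem IsDyadic.four_dvd {i : ℕ} (h : IsDyadic i) : 4 ≤ i ∧ i % 4 = 0 := by
  obtain ⟨j, hj, rfl⟩ := h
  obtain ⟨k, rfl⟩ := Nat.exists_eq_add_of_le hj
  have := Nat.one_le_two_pow (n := k)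
  rw [pow_add]
  omega

open Finset Classical in
/-- A sequence `x` can be moved into any VT class by changing only its first three entries and its
entries at powers of two, provided each entry at a power of two repeats its predecessor and may be
decreased by one without affecting the comparison with its successor. -/
theorem exists_adjusted_sequence (n t q : ℕ) (hn : 6 ≤ n) (hq : 4 ≤ q) (hnt : n ≤ 2 ^ t)
    (htn : ∀ j < t, 2 ^ j < n) (x : ℕ → ℕ) (hx : ∀ i, x i < q) (hx3 : x 3 = q - 1)
    (hrep : ∀ p, IsDyadic p → x p = x (p - 1)) (hpos : ∀ p < n, IsDyadic p → 1 ≤ x (p - 1))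
    (hnext : ∀ p, IsDyadic p → x (p + 1) + 1 ≠ x p) (a b : ℕ) (ha : a < n) (hb : b < q) :
    ∃ y : ℕ → ℕ, (∀ i, y i < q) ∧ (∀ i, 3 ≤ i → ¬ IsDyadic i → y i = x i) ∧
      (∑ i ∈ range (n - 1), (i + 1) * (if y i ≤ y (i + 1) then 1 else 0)) % n = a ∧
      (∑ i ∈ range n, y i) % q = b := by
  set P : Finset ℕ := (range t).image (2 ^ ·) with hP
  have hPsub : P ⊆ Ico 1 n := by
    intro i hi
    obtain ⟨j, hj, rfl⟩ := mem_image.1 hi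
    exact mem_Ico.2 ⟨Nat.one_le_two_pow, htn j (mem_range.1 hj)⟩
  obtain ⟨N, hN, hNa⟩ := exists_add_mod_eq n a
    (∑ i ∈ Ico 1 n \ P, i * (if x (i - 1) ≤ x i then 1 else 0)) ha
  set y₀ : ℕ → ℕ := fun i => if IsDyadic i then x i - (1 - N / i % 2) else x i with hy₀
  obtain ⟨c, -, hcb⟩ := exists_add_mod_eq q b (∑ i ∈ Ico 3 n, y₀ i) hb
  obtain ⟨u, v, w, hu, hv, hw, huv, hvw, hsum⟩ :=
    exists_triple q hq (N / 1 % 2 = 1) (N / 2 % 2 = 1) c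
  set y : ℕ → ℕ := fun i => if i = 0 then u else if i = 1 then v else if i = 2 then w else y₀ i
    with hy
  have y_of_three_le : ∀ i, 3 ≤ i → y i = y₀ i := fun i hi => by
    simp only [hy]
    rw [if_neg (by omega), if_neg (by omega), if_neg (by omega)]
  have hyx : ∀ i, 3 ≤ i → ¬ IsDyadic i → y i = x i := fun i hi hd => by
    rw [y_of_three_le i hi, hy₀]
    exact if_neg hd
  have hyd : ∀ i, IsDyadic i → y i = x i - (1 - N / i % 2) := fun i hd => by
    have := hd.four_dvd
    rw [y_of_three_le i (by omega), hy₀]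
    exact if_pos hd
  have hylt : ∀ i, y i < q := fun i => by
    have := hx i
    simp only [hy, hy₀]
    split_ifs <;> omega
  refine ⟨y, hylt, hyx, ?_, ?_⟩
  · have hshift : ∑ i ∈ range (n - 1), (i + 1) * (if y i ≤ y (i + 1) then 1 else 0) =
        ∑ i ∈ Ico 1 n, i * (if y (i - 1) ≤ y i then 1 else 0) := by
      rw [sum_Ico_eq_sum_range]
      refine sum_congr rfl fun i _ => ?_
      rw [Nat.add_sub_cancel_left, add_comm 1 i]
    have hdy : ∑ i ∈ P, i * (if y (i - 1) ≤ y i then 1 else 0) = N := by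
      rw [hP, sum_image fun i _ j _ h => Nat.pow_right_injective le_rfl h]
      refine Eq.trans ?_ ((sum_two_pow_mul_bit N t).trans (Nat.mod_eq_of_lt (hN.trans_le hnt)))
      refine sum_congr rfl fun j hj => ?_
      congr 1
      have hiff : y (2 ^ j - 1) ≤ y (2 ^ j) ↔ N / 2 ^ j % 2 = 1 := by
        rcases lt_or_ge j 2 with h | h
        · interval_cases j
          · simpa [hy] using huv
          · simpa [hy] using hvw
        · have hd : IsDyadic (2 ^ j) := ⟨j, h, rfl⟩
          have h4 := hd.four_dvd
          have hnd : ¬ IsDyadic (2 ^ j - 1) := fun h' => by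
            have := h'.four_dvd
            omega
          have := hpos _ (htn j (mem_range.1 hj)) hd
          rw [hyx _ (by omega) hnd, hyd _ hd, hrep _ hd]
          omega
      split_ifs with hle <;> omega
    have hnd : ∑ i ∈ Ico 1 n \ P, i * (if y (i - 1) ≤ y i then 1 else 0) =
        ∑ i ∈ Ico 1 n \ P, i * (if x (i - 1) ≤ x i then 1 else 0) := by
      refine sum_congr rfl fun i hi => ?_
      obtain ⟨hi, hiP⟩ := mem_sdiff.1 hi
      have hin := mem_Ico.1 hi
      have hpow : ∀ j, i ≠ 2 ^ j := fun j hj => hiP <| mem_image.2 ⟨j, mem_range.2 <| by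
        by_contra hjt
        have := Nat.pow_le_pow_right (n := 2) (by omega) (not_lt.1 hjt)
        omega, hj.symm⟩
      have h1 := hpow 0
      have h2 := hpow 1
      have hi3 : 3 ≤ i := by
        norm_num at h1 h2
        omega
      have hid : ¬ IsDyadic i := fun ⟨j, _, hj⟩ => hpow j hj
      congr 2
      rw [hyx i hi3 hid]
      by_cases h3 : i = 3
      · subst h3
        have := hylt (3 - 1)
        have := hx (3 - 1)
        simp only [eq_iff_iff]
        omega
      by_cases hp : IsDyadic (i - 1)
      · have := hnext _ hp
        have := hp.four_dvd
        rw [Nat.sub_add_cancel (by omega)] at *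
        rw [hyd _ hp, eq_iff_iff]
        omega
      · rw [hyx _ (by omega) hp]
    rw [hshift, ← sum_sdiff hPsub, hdy, hnd, add_comm, hNa]
  · rw [range_eq_Ico, ← sum_Ico_consecutive _ (Nat.zero_le 3) (by omega : 3 ≤ n),
      sum_congr rfl fun i hi => y_of_three_le i (mem_Ico.1 hi).1]
    have : ∑ i ∈ Ico 0 3, y i = u + v + w := by
      simp [hy, sum_range_succ]
    rw [this, Nat.add_mod, hsum, ← Nat.add_mod, hcb]

open Classical in
/-- The sequence encoding a message `m`: entries at powers of two repeat their predecessor, the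
entry following a power of two skips one value, and entry 3 is maximal. -/
noncomputable def encode (q : ℕ) (m : ℕ → ℕ) (i : ℕ) : ℕ :=
  let c : ℕ → ℕ := fun k => if k = 3 then q - 1 else m k
  if IsDyadic i then c (i - 1)
  else if IsDyadic (i - 1) then (if m i + 1 < c (i - 2) then m i else m i + 1)
  else c i

theorem encode_of_not_isDyadic {q : ℕ} {m : ℕ → ℕ} {i : ℕ} (h : ¬ IsDyadic i)
    (h' : ¬ IsDyadic (i - 1)) : encode q m i = if i = 3 then q - 1 else m i := by
  simp [encode, h, h']

theorem encode_pred {q : ℕ} {m : ℕ → ℕ} {p : ℕ} (hp : IsDyadic p) :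
    encode q m (p - 1) = if p - 1 = 3 then q - 1 else m (p - 1) := by
  have := hp.four_dvd
  refine encode_of_not_isDyadic (fun h => ?_) (fun h => ?_) <;>
  · have := h.four_dvd
    omega

theorem encode_self {q : ℕ} {m : ℕ → ℕ} {p : ℕ} (hp : IsDyadic p) :
    encode q m p = encode q m (p - 1) := by
  rw [encode_pred hp]
  simp [encode, hp]

theorem encode_succ {q : ℕ} {m : ℕ → ℕ} {p : ℕ} (hp : IsDyadic p) :
    encode q m (p + 1) = if m (p + 1) + 1 < encode q m (p - 1) then m (p + 1)
      else m (p + 1) + 1 := by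
  have := hp.four_dvd
  have hs : ¬ IsDyadic (p + 1) := fun h => by
    have := h.four_dvd
    omega
  rw [encode_pred hp]
  simp [encode, hp, hs]

/-- Positions at which messages carry no information. -/
def frozenPositions (t : ℕ) : Finset ℕ := Finset.range 4 ∪ (Finset.Ico 2 t).image (2 ^ ·)

/-- Positions adjacent to a power of two. -/
def neighborPositions (t : ℕ) : Finset ℕ :=
  (Finset.Ico 2 t).image (2 ^ · + 1) ∪ (Finset.Ico 3 t).image (2 ^ · - 1)

theorem card_frozenPositions_le {t : ℕ} (ht : 3 ≤ t) : (frozenPositions t).card ≤ t + 2 := by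
  refine (Finset.card_union_le _ _).trans ?_
  have := Finset.card_image_le (s := Finset.Ico 2 t) (f := fun j => 2 ^ j)
  simp only [Nat.card_Ico, Finset.card_range] at *
  omega

theorem card_neighborPositions_le {t : ℕ} (ht : 3 ≤ t) :
    (neighborPositions t).card + 5 ≤ 2 * t := by
  have h := Finset.card_union_le ((Finset.Ico 2 t).image (2 ^ · + 1))
    ((Finset.Ico 3 t).image (2 ^ · - 1))
  have h1 := Finset.card_image_le (s := Finset.Ico 2 t) (f := fun j => 2 ^ j + 1)
  have h2 := Finset.card_image_le (s := Finset.Ico 3 t) (f := fun j => 2 ^ j - 1)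
  simp only [Nat.card_Ico] at *
  unfold neighborPositions
  omega

open Classical in
/-- The symbols that a message may use at position `i`. -/
noncomputable def messageSymbols (q t i : ℕ) : Finset (Fin q) :=
  if i ∈ frozenPositions t then Finset.univ.filter (fun v => v.val = 0)
  else if i ∈ neighborPositions t then
    (if IsDyadic (i - 1) then Finset.univ.filter (fun v => v.val ≠ q - 1)
      else Finset.univ.filter (fun v => v.val ≠ 0))
  else Finset.univ

theorem card_messageSymbols {q : ℕ} (hq : 1 ≤ q) (t i : ℕ) :
    (messageSymbols q t i).card = if i ∈ frozenPositions t then 1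
      else if i ∈ neighborPositions t then q - 1 else q := by
  have key : ∀ k (hk : k < q), (Finset.univ.filter fun v : Fin q => v.val = k) = {⟨k, hk⟩} :=
    fun k hk => by
      ext v
      simp [Fin.ext_iff]
  have key' : ∀ k (hk : k < q), (Finset.univ.filter fun v : Fin q => v.val ≠ k).card = q - 1 :=
    fun k hk => by
      have := Finset.card_filter_add_card_filter_not (s := Finset.univ)
        (fun v : Fin q => v.val = k)
      rw [key k hk, Finset.card_singleton, Finset.card_univ, Fintype.card_fin] at this
      simp only [ne_eq]
      omega
  unfold messageSymbols
  split_ifs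
  · rw [key 0 (by omega), Finset.card_singleton]
  · exact key' _ (by omega)
  · exact key' _ (by omega)
  · simp

open Finset in
theorem prod_card_messageSymbols_le_card_VTq (n q t : ℕ) (hn : 6 ≤ n) (hq : 4 ≤ q)
    (hnt : n ≤ 2 ^ t) (htn : ∀ j < t, 2 ^ j < n) (a b : ℕ) (ha : a < n) (hb : b < q) :
    ∏ i : Fin n, (messageSymbols q t i).card ≤ (VTq n q a b).card := by
  have lt_of_pow : ∀ j, 2 ^ j < n → j < t := fun j hj => by
    by_contra h
    have := Nat.pow_le_pow_right (n := 2) (by omega) (not_lt.1 h)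
    omega
  let ext : (Fin n → Fin q) → ℕ → ℕ := fun m i => if h : i < n then (m ⟨i, h⟩).val else 0
  have ext_mem : ∀ m ∈ Fintype.piFinset fun i : Fin n => messageSymbols q t i,
      ∀ i (h : i < n), ext m i = (m ⟨i, h⟩).val ∧ m ⟨i, h⟩ ∈ messageSymbols q t i :=
    fun m hm i h => ⟨dif_pos h, Fintype.mem_piFinset.1 hm ⟨i, h⟩⟩
  have ext_lt : ∀ m i, ext m i < q := fun m i => by
    simp only [ext]
    split_ifs
    · exact Fin.isLt _
    · omega
  have ext_frozen : ∀ m ∈ Fintype.piFinset fun i : Fin n => messageSymbols q t i,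
      ∀ i < n, i ≤ 3 ∨ IsDyadic i → ext m i = 0 := fun m hm i hi hf => by
    obtain ⟨h1, h2⟩ := ext_mem m hm i hi
    have : i ∈ frozenPositions t := by
      rcases hf with hf | ⟨j, hj, rfl⟩
      · exact mem_union_left _ (mem_range.2 (by omega))
      · exact mem_union_right _ (mem_image.2 ⟨j, mem_Ico.2 ⟨hj, lt_of_pow j hi⟩, rfl⟩)
    rw [messageSymbols, if_pos this, mem_filter] at h2
    rw [h1, h2.2]
  have not_frozen : ∀ i, 3 < i → ¬ IsDyadic i → i ∉ frozenPositions t := fun i hi hd hmem => by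
    rcases mem_union.1 hmem with h | h
    · have := mem_range.1 h
      omega
    · obtain ⟨j, hj, rfl⟩ := mem_image.1 h
      exact hd ⟨j, (mem_Ico.1 hj).1, rfl⟩
  have ext_succ : ∀ m ∈ Fintype.piFinset fun i : Fin n => messageSymbols q t i,
      ∀ p, IsDyadic p → ext m (p + 1) + 1 < q := fun m hm p hp => by
    have h4 := hp.four_dvd
    by_cases hpn : p + 1 < n
    · obtain ⟨h1, h2⟩ := ext_mem m hm _ hpn
      have hmem : p + 1 ∈ neighborPositions t := by
        obtain ⟨j, hj, rfl⟩ := hp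
        exact mem_union_left _ (mem_image.2 ⟨j, mem_Ico.2 ⟨hj, lt_of_pow j (by omega)⟩, rfl⟩)
      rw [messageSymbols, if_neg (not_frozen _ (by omega) fun h => by
        have := h.four_dvd
        omega), if_pos hmem, if_pos (by simpa using hp), mem_filter] at h2
      have := h2.2
      have := ext_lt m (p + 1)
      omega
    · simp only [ext, dif_neg hpn]
      omega
  have ext_pred : ∀ m ∈ Fintype.piFinset fun i : Fin n => messageSymbols q t i,
      ∀ p < n, IsDyadic p → p - 1 ≠ 3 → 1 ≤ ext m (p - 1) := fun m hm p hpn hp h3 => by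
    have h4 := hp.four_dvd
    obtain ⟨h1, h2⟩ := ext_mem m hm (p - 1) (by omega)
    have hmem : p - 1 ∈ neighborPositions t := by
      obtain ⟨j, hj, rfl⟩ := hp
      have : j ≠ 2 := by
        rintro rfl
        norm_num at h3
      exact mem_union_right _
        (mem_image.2 ⟨j, mem_Ico.2 ⟨by omega, lt_of_pow j (by omega)⟩, rfl⟩)
    rw [messageSymbols, if_neg (not_frozen _ (by omega) fun h => by
      have := h.four_dvd
      omega), if_pos hmem, if_neg (fun h => by
      have := h.four_dvd
      omega), mem_filter] at h2
    have := h2.2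
    omega
  have exists_codeword : ∀ m ∈ Fintype.piFinset fun i : Fin n => messageSymbols q t i,
      ∃ S ∈ VTq n q a b, ∀ i : Fin n, 3 ≤ i.val → ¬ IsDyadic i →
        (S i).val = encode q (ext m) i := fun m hm => by
    obtain ⟨y, hyq, hyx, hsyn, hsum⟩ := exists_adjusted_sequence n t q hn hq hnt htn
      (encode q (ext m)) (fun i => by
        have := ext_lt m i
        have := ext_lt m (i - 1)
        by_cases hi : IsDyadic i
        · rw [encode_self hi, encode_pred hi]
          split_ifs <;> omega
        by_cases hi' : IsDyadic (i - 1)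
        · have h4 := hi'.four_dvd
          have := ext_succ m hm _ hi'
          have he := encode_succ (q := q) (m := ext m) hi'
          rw [Nat.sub_add_cancel (by omega)] at *
          rw [he]
          split_ifs <;> omega
        · rw [encode_of_not_isDyadic hi hi']
          split_ifs <;> omega)
      (by
        rw [encode_of_not_isDyadic, if_pos rfl] <;>
        · intro h
          have := h.four_dvd
          omega)
      (fun p hp => encode_self hp)
      (fun p hpn hp => by
        rw [encode_pred hp]
        split_ifs with h
        · omega
        · exact ext_pred m hm p hpn hp h)
      (fun p hp => by
        rw [encode_succ hp, encode_self hp]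
        split_ifs <;> omega) a b ha hb
    refine ⟨fun i => ⟨y i, hyq i⟩, ?_, fun i h3 hd => hyx i h3 hd⟩
    refine mem_filter.2 ⟨mem_univ _, ?_, ?_⟩
    · rw [← Fin.sum_univ_eq_sum_range
        (fun i => (i + 1) * (if y i ≤ y (i + 1) then 1 else 0))] at hsyn
      exact hsyn
    · rw [← Fin.sum_univ_eq_sum_range] at hsum
      exact hsum
  choose! f hf hfe using exists_codeword
  rw [← Fintype.card_piFinset]
  refine card_le_card_of_injOn f hf fun m hm m' hm' hmm => ?_
  rw [mem_coe] at hm hm'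
  have henc : ∀ i < n, 3 ≤ i → ¬ IsDyadic i → encode q (ext m) i = encode q (ext m') i :=
    fun i hi h3 hd => by
      rw [← hfe m hm ⟨i, hi⟩ h3 hd, ← hfe m' hm' ⟨i, hi⟩ h3 hd, hmm]
  have hext : ∀ i < n, ext m i = ext m' i := fun i hi => by
    by_cases hfr : i ≤ 3 ∨ IsDyadic i
    · rw [ext_frozen m hm i hi hfr, ext_frozen m' hm' i hi hfr]
    obtain ⟨h3, hd⟩ := not_or.1 hfr
    have he := henc i hi (by omega) hd
    by_cases hp : IsDyadic (i - 1)
    · have h4 := hp.four_dvd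
      have he' := henc (i - 1 - 1) (by omega) (by omega) fun h => by
        have := h.four_dvd
        omega
      obtain ⟨p, rfl⟩ : ∃ p, i = p + 1 := ⟨i - 1, by omega⟩
      rw [Nat.add_sub_cancel] at hp he'
      rw [encode_succ hp, encode_succ hp, he'] at he
      split_ifs at he <;> omega
    · rwa [encode_of_not_isDyadic hd hp, encode_of_not_isDyadic hd hp, if_neg (by omega),
        if_neg (by omega)] at he
  funext i
  have := hext i i.isLt
  simp only [ext, i.isLt, dif_pos] at this
  exact Fin.ext this

open Finset in
theorem logb_prod_card_messageSymbols_ge (n q t : ℕ) (hq : 4 ≤ q) (ht : 3 ≤ t) :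
    n * Real.logb 2 q - (t + 2) * Real.logb 2 q
        - (2 * t - 5) * (Real.logb 2 q - Real.logb 2 ((q : ℝ) - 1)) ≤
      Real.logb 2 (∏ i : Fin n, (messageSymbols q t i).card : ℕ) := by
  have hq' : (4 : ℝ) ≤ q := by exact_mod_cast hq
  set L := Real.logb 2 q
  set M := Real.logb 2 ((q : ℝ) - 1)
  have hML : M ≤ L := Real.logb_le_logb_of_le (by norm_num) (by linarith) (by linarith)
  have hL : 0 ≤ L := Real.logb_nonneg (by norm_num) (by linarith)
  have hterm : ∀ i : ℕ, L - (if i ∈ frozenPositions t then L else 0)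
      - (if i ∈ neighborPositions t then L - M else 0) ≤
      Real.logb 2 (messageSymbols q t i).card := fun i => by
    rw [card_messageSymbols (by omega)]
    split_ifs
    · simp [hML]
    · simp
    · rw [Nat.cast_sub (by omega), Nat.cast_one]
      simp [M]
    · simp [L]
  have hcount : ∀ (s : Finset ℕ) (c : ℝ), 0 ≤ c →
      ∑ i ∈ range n, (if i ∈ s then c else 0) ≤ s.card * c := fun s c hc => by
    rw [← sum_filter, sum_const, nsmul_eq_mul]
    gcongr
    exact fun i hi => (mem_filter.1 hi).2
  have h1 : ((frozenPositions t).card : ℝ) ≤ t + 2 := by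
    exact_mod_cast card_frozenPositions_le ht
  have h2 : ((neighborPositions t).card : ℝ) + 5 ≤ 2 * t := by
    exact_mod_cast card_neighborPositions_le ht
  rw [Nat.cast_prod, Real.logb_prod _ _ fun i _ => by
      rw [card_messageSymbols (by omega)]
      split_ifs <;> norm_cast <;> omega,
    Fin.sum_univ_eq_sum_range (fun i => Real.logb 2 (messageSymbols q t i).card)]
  refine le_trans ?_ (sum_le_sum fun i _ => hterm i)
  rw [sum_sub_distrib, sum_sub_distrib, sum_const, card_range, nsmul_eq_mul]
  have h3 := (hcount (frozenPositions t) L hL).trans (mul_le_mul_of_nonneg_right h1 hL)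
  have h4 := (hcount (neighborPositions t) (L - M) (by linarith)).trans
    (mul_le_mul_of_nonneg_right (by linarith : _ ≤ (2 * t - 5 : ℝ)) (by linarith))
  linarith

theorem vt_qary_rate_lower_bound (n q : ℕ) (hn : 6 ≤ n) (hq : 4 ≤ q)
    (t : ℕ) (ht : t = Nat.clog 2 n)
    (a b : ℕ) (ha : a ≤ n - 1) (hb : b < q) :
    Real.logb 2 ((VTq n q a b).card) / n ≥
      Real.logb 2 q
        - ((t : ℝ) / n) * (3 * Real.logb 2 q - 2 * Real.logb 2 ((q : ℝ) - 1))
        - (1 / n) * (5 * Real.logb 2 ((q : ℝ) - 1) - 3 * Real.logb 2 q) := by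
  subst ht
  have hnt : n ≤ 2 ^ Nat.clog 2 n := Nat.le_pow_clog (by norm_num) n
  have htn : ∀ j < Nat.clog 2 n, 2 ^ j < n := fun j hj => (Nat.lt_clog_iff_pow_lt (by norm_num)).1 hj
  have ht : 3 ≤ Nat.clog 2 n := (Nat.lt_clog_iff_pow_lt (by norm_num)).2 (by omega)
  generalize Nat.clog 2 n = t at *
  have hlog := logb_prod_card_messageSymbols_ge n q t hq ht
  have hcard := prod_card_messageSymbols_le_card_VTq n q t hn hq hnt htn a b (by omega) hb
  have hprod : 0 < ∏ i : Fin n, (messageSymbols q t i).card := Finset.prod_pos fun i _ => by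
    rw [card_messageSymbols (by omega)]
    split_ifs <;> omega
  have hle := hlog.trans (Real.logb_le_logb_of_le (by norm_num) (by exact_mod_cast hprod)
    (Nat.cast_le.2 hcard))
  have hn0 : (0 : ℝ) < n := by
    norm_cast
    omega
  rw [ge_iff_le, le_div_iff₀ hn0]
  refine le_trans (le_of_eq ?_) hle
  field_simp
  ring
end

section
/- Let m ≥ 2 be an integer, q = 2^m, n ≥ 6, and t = ⌈log₂ n⌉. Set k = n·m − t·(m+1) − 2·(m−1). Then for every a with 0 ≤ a ≤ n−1 and every b ∈ Z_q, the q-ary Varshamov–Tenengolts code VT_{a,b}(n) satisfies |VT_{a,b}(n)| ≥ 2^k. (This is the guarantee provided by the systematic encoder mapping k message bits injectively into VT_{a,b}(n) when q is a power of two.) -/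
open Finset

open scoped Classical in
/-- The number of bits of the `i`-th symbol that carry no information. -/
noncomputable def bitLoss (m i : ℕ) : ℕ :=
  (if i < 4 then m else 0) + (if 4 ≤ i ∧ ∃ j, i = 2 ^ j then m else 0) +
    (if 4 ≤ i ∧ ∃ j, i + 1 = 2 ^ j then 1 else 0)

/-- The `u`-th element of `{x | 1 ≤ x ∧ x ≠ y + 1}`. -/
def skipSucc (u y : ℕ) : ℕ := if u < y then u + 1 else u + 2

open scoped Classical in
/-- The codeword with message symbols `f`, first three symbols `c₀ c₁ c₂`, and an ascent at the
dyadic position `i ≥ 4` exactly when `i ∈ E`. -/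
noncomputable def dyadicSeq (c₀ c₁ c₂ : ℕ) (f : ℕ → ℕ) (E : Finset ℕ) (i : ℕ) : ℕ :=
  if i = 0 then c₀ else if i = 1 then c₁ else if i = 2 then c₂
  else if ∃ j, i + 1 = 2 ^ j then skipSucc (f i) (f (i + 2))
  else if ∃ j, i = 2 ^ j then skipSucc (f (i - 1)) (f (i + 1)) - (if i ∈ E then 0 else 1)
  else f i

theorem four_dvd_of_eq_two_pow {i : ℕ} (hi : 4 ≤ i) (h : ∃ j, i = 2 ^ j) : 4 ∣ i := by
  obtain ⟨j, rfl⟩ := h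
  have : 2 ≤ j := by
    by_contra! hj
    interval_cases j <;> omega
  exact pow_dvd_pow 2 this

theorem sum_bitLoss_le {m n t : ℕ} (ht : 2 ≤ t) (hn : n ≤ 2 ^ t) (hm : 2 ≤ m) :
    ∑ i ∈ range n, bitLoss m i ≤ t * (m + 1) + 2 * (m - 1) := by
  classical
  have h₁ : #{i ∈ range n | i < 4} ≤ 4 := by
    calc _ ≤ #(range 4) := card_le_card fun i hi => by simp_all
      _ = 4 := by simp
  have h₂ : #{i ∈ range n | 4 ≤ i ∧ ∃ j, i = 2 ^ j} ≤ t - 2 := by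
    calc _ ≤ #((Ico 2 t).image (2 ^ ·)) := card_le_card fun i hi => by
          simp only [mem_filter, mem_range] at hi
          obtain ⟨hin, hi4, j, rfl⟩ := hi
          refine mem_image.2 ⟨j, mem_Ico.2 ⟨?_, ?_⟩, rfl⟩
          · exact (Nat.pow_le_pow_iff_right (a := 2) one_lt_two).1 hi4
          · exact (Nat.pow_lt_pow_iff_right (a := 2) one_lt_two).1 (hin.trans_le hn)
      _ ≤ t - 2 := card_image_le.trans (by simp)
  have h₃ : #{i ∈ range n | 4 ≤ i ∧ ∃ j, i + 1 = 2 ^ j} ≤ t - 2 := by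
    calc _ ≤ #((Ico 3 (t + 1)).image (2 ^ · - 1)) := card_le_card fun i hi => by
          simp only [mem_filter, mem_range] at hi
          obtain ⟨hin, hi4, j, hj⟩ := hi
          refine mem_image.2 ⟨j, mem_Ico.2 ⟨?_, ?_⟩, by simp only [← hj]; omega⟩
          · exact (Nat.pow_lt_pow_iff_right (a := 2) one_lt_two).1 (by omega : 2 ^ 2 < 2 ^ j)
          · exact Nat.lt_succ_of_le
              ((Nat.pow_le_pow_iff_right (a := 2) one_lt_two).1 (by omega))
      _ ≤ t - 2 := card_image_le.trans (by simp)
  simp only [bitLoss, sum_add_distrib, ← sum_filter, sum_const, smul_eq_mul]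
  obtain ⟨t, rfl⟩ := Nat.exists_eq_add_of_le ht
  obtain ⟨m, rfl⟩ := Nat.exists_eq_add_of_le hm
  simp only [Nat.add_sub_cancel_left] at h₂ h₃
  rw [show 2 + m - 1 = m + 1 by omega]
  nlinarith [Nat.mul_le_mul_right (2 + m) h₁, Nat.mul_le_mul_right (2 + m) h₂]

theorem skipSucc_pos (u y : ℕ) : 0 < skipSucc u y := by
  unfold skipSucc; split_ifs <;> omega

theorem skipSucc_ne (u y : ℕ) : skipSucc u y ≠ y + 1 := by
  unfold skipSucc; split_ifs <;> omega

theorem skipSucc_le (u y : ℕ) : skipSucc u y ≤ u + 2 := by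
  unfold skipSucc; split_ifs <;> omega

theorem le_skipSucc (u y : ℕ) : u + 1 ≤ skipSucc u y := by
  unfold skipSucc; split_ifs <;> omega

theorem skipSucc_injective (y : ℕ) : Function.Injective (skipSucc · y) := by
  intro u v h
  simp only [skipSucc] at h
  split_ifs at h <;> omega

theorem exists_initial_symbols {q y r z : ℕ} (hq : 4 ≤ q) (hy : q ≤ y + 2)
    (hr : r < 4) (hz : z < q) :
    ∃ c₀ c₁ c₂, c₀ < q ∧ c₁ < q ∧ c₂ < q ∧ (c₀ + c₁ + c₂) % q = z ∧
      (if c₀ ≤ c₁ then 1 else 0) + 2 * (if c₁ ≤ c₂ then 1 else 0) +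
        3 * (if c₂ ≤ y then 1 else 0) = 3 + r := by
  suffices ∃ c₀ c₁ c₂, c₀ < q ∧ c₁ < q ∧ c₂ < q ∧
      (c₀ + c₁ + c₂ = z ∨ c₀ + c₁ + c₂ = z + q) ∧
      (if c₀ ≤ c₁ then 1 else 0) + 2 * (if c₁ ≤ c₂ then 1 else 0) +
        3 * (if c₂ ≤ y then 1 else 0) = 3 + r by
    obtain ⟨c₀, c₁, c₂, h₀, h₁, h₂, hs, h⟩ := this
    refine ⟨c₀, c₁, c₂, h₀, h₁, h₂, ?_, h⟩
    rcases hs with hs | hs <;> simp [hs, Nat.mod_eq_of_lt hz]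
  interval_cases r
  · obtain hz | rfl | rfl | rfl : 3 ≤ z ∨ z = 0 ∨ z = 1 ∨ z = 2 := by omega
    · refine ⟨z - 1, 1, 0, ?_⟩; split_ifs <;> omega
    · refine ⟨q - 1, 1, 0, ?_⟩; split_ifs <;> omega
    · refine ⟨q - 1, 2, 0, ?_⟩; split_ifs <;> omega
    · refine ⟨q - 1, 2, 1, ?_⟩; split_ifs <;> omega
  · obtain h | h : z + 1 < q ∨ z + 1 = q := by omega
    · refine ⟨z + 1, q - 1, 0, ?_⟩; split_ifs <;> omega
    · refine ⟨0, q - 1, 0, ?_⟩; split_ifs <;> omega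
  · obtain h | rfl : 1 ≤ z ∨ z = 0 := by omega
    · refine ⟨z, 0, 0, ?_⟩; split_ifs <;> omega
    · refine ⟨q - 1, 0, 1, ?_⟩; split_ifs <;> omega
  · obtain h | h : z + 2 ≤ q ∨ z + 1 = q := by omega
    · refine ⟨0, 0, z, ?_⟩; split_ifs <;> omega
    · refine ⟨0, 1, q - 2, ?_⟩; split_ifs <;> omega

theorem exists_dyadic_positions (R : ℕ) :
    ∃ E : Finset ℕ, (∀ i ∈ E, 4 ≤ i ∧ ∃ j, i = 2 ^ j) ∧ ∑ i ∈ E, i = 4 * R := by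
  refine ⟨R.bitIndices.toFinset.image fun j => 2 ^ (j + 2), ?_, ?_⟩
  · simp only [mem_image]
    rintro _ ⟨j, -, rfl⟩
    exact ⟨by rw [pow_add]; have := Nat.one_le_two_pow (n := j); omega, _, rfl⟩
  · rw [sum_image fun a _ b _ h => by simpa using h]
    simp only [pow_add, ← sum_mul]
    rw [mul_comm, Finset.sum_toFinset_bitIndices_two_pow]
    norm_num

section dyadicSeq

variable (c₀ c₁ c₂ : ℕ) (f : ℕ → ℕ) (E : Finset ℕ) {i : ℕ}

theorem dyadicSeq_pred_pow (hi : 3 ≤ i) (h : ∃ j, i + 1 = 2 ^ j) :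
    dyadicSeq c₀ c₁ c₂ f E i = skipSucc (f i) (f (i + 2)) := by
  rw [dyadicSeq, if_neg (by omega), if_neg (by omega), if_neg (by omega), if_pos h]

theorem dyadicSeq_pow (hi : 4 ≤ i) (h : ∃ j, i = 2 ^ j) :
    dyadicSeq c₀ c₁ c₂ f E i =
      skipSucc (f (i - 1)) (f (i + 1)) - (if i ∈ E then 0 else 1) := by
  have h' : ¬ ∃ j, i + 1 = 2 ^ j := fun h' => by
    have := four_dvd_of_eq_two_pow hi h
    have := four_dvd_of_eq_two_pow (by omega) h'
    omega
  rw [dyadicSeq, if_neg (by omega), if_neg (by omega), if_neg (by omega), if_neg h', if_pos h]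

theorem dyadicSeq_of_not_pow (hi : 3 ≤ i) (h : ¬ ∃ j, i = 2 ^ j) (h' : ¬ ∃ j, i + 1 = 2 ^ j) :
    dyadicSeq c₀ c₁ c₂ f E i = f i := by
  rw [dyadicSeq, if_neg (by omega), if_neg (by omega), if_neg (by omega), if_neg h', if_neg h]

theorem dyadicSeq_succ_pow (hi : 4 ≤ i) (h : ∃ j, i = 2 ^ j) :
    dyadicSeq c₀ c₁ c₂ f E (i + 1) = f (i + 1) := by
  have := four_dvd_of_eq_two_pow hi h
  refine dyadicSeq_of_not_pow _ _ _ _ _ (by omega) (fun h' => ?_) (fun h' => ?_) <;>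
  · have := four_dvd_of_eq_two_pow (by omega) h'
    omega

/-- The dyadic positions control their own ascent bit without changing the next one. -/
theorem dyadicSeq_ascent (hE : ∀ i ∈ E, 4 ≤ i ∧ ∃ j, i = 2 ^ j) (hi : 3 ≤ i) :
    (i + 1) * (if dyadicSeq c₀ c₁ c₂ f E i ≤ dyadicSeq c₀ c₁ c₂ f E (i + 1) then 1 else 0) =
      (i + 1) * (if dyadicSeq 0 0 0 f ∅ i ≤ dyadicSeq 0 0 0 f ∅ (i + 1) then 1 else 0) +
        if i + 1 ∈ E then i + 1 else 0 := by
  by_cases h₁ : ∃ j, i + 1 = 2 ^ j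
  · have := skipSucc_pos (f i) (f (i + 2))
    simp only [dyadicSeq_pred_pow _ _ _ _ _ hi h₁, dyadicSeq_pow _ _ _ _ _ (by omega) h₁,
      Nat.add_sub_cancel, add_assoc, Nat.reduceAdd]
    by_cases hE' : i + 1 ∈ E <;> simp [hE', this]
  · have hE' : i + 1 ∉ E := fun h => h₁ (hE _ h).2
    rw [if_neg hE', add_zero]
    congr 2
    by_cases h₀ : 4 ≤ i ∧ ∃ j, i = 2 ^ j
    · rw [dyadicSeq_succ_pow _ _ _ _ _ h₀.1 h₀.2, dyadicSeq_succ_pow _ _ _ _ _ h₀.1 h₀.2,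
        dyadicSeq_pow _ _ _ _ _ h₀.1 h₀.2, dyadicSeq_pow _ _ _ _ _ h₀.1 h₀.2]
      have := skipSucc_ne (f (i - 1)) (f (i + 1))
      simp only [notMem_empty, if_false, eq_iff_iff]
      split_ifs <;> omega
    · have hne : ∀ k, 3 ≤ k → (k = i ∨ k = i + 1) →
          dyadicSeq c₀ c₁ c₂ f E k = dyadicSeq 0 0 0 f ∅ k := by
        intro k hk hki
        have hkp : ¬ ∃ j, k = 2 ^ j := by
          rcases hki with rfl | rfl
          · intro h
            obtain rfl : k = 3 := by
              by_contra
              exact h₀ ⟨by omega, h⟩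
            exact h₁ ⟨2, rfl⟩
          · exact h₁
        by_cases hk' : ∃ j, k + 1 = 2 ^ j
        · rw [dyadicSeq_pred_pow _ _ _ _ _ hk hk', dyadicSeq_pred_pow _ _ _ _ _ hk hk']
        · rw [dyadicSeq_of_not_pow _ _ _ _ _ hk hkp hk',
            dyadicSeq_of_not_pow _ _ _ _ _ hk hkp hk']
      rw [hne i hi (.inl rfl), hne (i + 1) (by omega) (.inr rfl)]

theorem dyadicSeq_lt {q n : ℕ} (h₀ : c₀ < q) (h₁ : c₁ < q) (h₂ : c₂ < q)
    (hf : ∀ i < n, f i < q) (hf' : ∀ i < n, 3 ≤ i → (∃ j, i + 1 = 2 ^ j) → f i + 2 < q)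
    (hi : i < n) : dyadicSeq c₀ c₁ c₂ f E i < q := by
  obtain rfl | rfl | rfl | hi3 : i = 0 ∨ i = 1 ∨ i = 2 ∨ 3 ≤ i := by omega
  · simpa [dyadicSeq]
  · simpa [dyadicSeq]
  · simpa [dyadicSeq]
  by_cases hp : ∃ j, i + 1 = 2 ^ j
  · rw [dyadicSeq_pred_pow _ _ _ _ _ hi3 hp]
    exact (skipSucc_le _ _).trans_lt (hf' i hi hi3 hp)
  by_cases hp' : ∃ j, i = 2 ^ j
  · have hi4 : 4 ≤ i := by
      by_contra
      obtain rfl : i = 3 := by omega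
      exact hp ⟨2, rfl⟩
    rw [dyadicSeq_pow _ _ _ _ _ hi4 hp']
    have := hf' (i - 1) (by omega) (by omega) (by rwa [Nat.sub_add_cancel (by omega)])
    have := skipSucc_le (f (i - 1)) (f (i + 1))
    omega
  · rw [dyadicSeq_of_not_pow _ _ _ _ _ hi3 hp' hp]
    exact hf i hi

end dyadicSeq

/-- Every message extends to a sequence with prescribed syndrome and modular sum. -/
theorem exists_dyadicSeq {q n a b : ℕ} (hq : 4 ≤ q) (hn : 6 ≤ n) (ha : a < n) (hb : b < q)
    (f : ℕ → ℕ) (hf : ∀ i < n, f i < q)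
    (hf' : ∀ i < n, 3 ≤ i → (∃ j, i + 1 = 2 ^ j) → f i + 2 < q) (hf3 : f 3 + 3 = q) :
    ∃ c₀ c₁ c₂ E, (∀ i < n, dyadicSeq c₀ c₁ c₂ f E i < q) ∧
      (∑ i ∈ range (n - 1), (i + 1) *
        (if dyadicSeq c₀ c₁ c₂ f E i ≤ dyadicSeq c₀ c₁ c₂ f E (i + 1) then 1 else 0)) % n = a ∧
      (∑ i ∈ range n, dyadicSeq c₀ c₁ c₂ f E i) % q = b := by
  obtain ⟨l, rfl⟩ : ∃ l, n = l + 4 := ⟨n - 4, by omega⟩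
  set K := ∑ i ∈ range l, (i + 3 + 1) *
    (if dyadicSeq 0 0 0 f ∅ (i + 3) ≤ dyadicSeq 0 0 0 f ∅ (i + 3 + 1) then 1 else 0) with hK
  obtain ⟨T, hT, hTa⟩ : ∃ T < l + 4, (3 + T + K) % (l + 4) = a := by
    refine ⟨(a + ((l + 4) - (3 + K) % (l + 4))) % (l + 4), Nat.mod_lt _ (by omega), ?_⟩
    have hlt := Nat.mod_lt (3 + K) (by omega : 0 < l + 4)
    rw [show ∀ x, 3 + x + K = x + (3 + K) by intro x; ring, Nat.mod_add_mod, Nat.add_mod,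
      ← Nat.add_mod_mod, Nat.mod_mod, Nat.mod_add_mod, add_assoc, Nat.sub_add_cancel hlt.le,
      Nat.add_mod_right, Nat.mod_eq_of_lt ha]
  obtain ⟨E, hE, hsum⟩ := exists_dyadic_positions (T / 4)
  have hET : ∀ i ∈ E, i ≤ T := fun i hi => by
    have := single_le_sum (f := fun i => i) (fun _ _ => Nat.zero_le _) hi
    omega
  set Y := ∑ i ∈ range (l + 1), dyadicSeq 0 0 0 f E (i + 3) with hY
  obtain ⟨z, hz, hzb⟩ : ∃ z < q, (z + Y) % q = b := by
    refine ⟨(b + (q - Y % q)) % q, Nat.mod_lt _ (by omega), ?_⟩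
    have hlt := Nat.mod_lt Y (by omega : 0 < q)
    rw [Nat.mod_add_mod, ← Nat.add_mod_mod, add_assoc, Nat.sub_add_cancel hlt.le,
      Nat.add_mod_right, Nat.mod_eq_of_lt hb]
  have hy : q ≤ skipSucc (f 3) (f 5) + 2 := by
    have := le_skipSucc (f 3) (f 5)
    omega
  obtain ⟨c₀, c₁, c₂, h₀, h₁, h₂, hcz, hcr⟩ :=
    exists_initial_symbols hq hy (Nat.mod_lt T (by norm_num : 0 < 4)) hz
  refine ⟨c₀, c₁, c₂, E, fun i hi => dyadicSeq_lt _ _ _ _ _ h₀ h₁ h₂ hf hf' hi, ?_, ?_⟩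
  · have hEsum : ∑ i ∈ range l, (if i + 3 + 1 ∈ E then i + 3 + 1 else 0) = 4 * (T / 4) := by
      rw [← hsum, ← sum_filter]
      refine sum_bij (fun i _ => i + 3 + 1) (fun i hi => (mem_filter.1 hi).2)
        (fun i _ j _ h => by omega) (fun i hi => ?_) (fun _ _ => rfl)
      have := hET i hi
      have := (hE i hi).1
      refine ⟨i - 4, mem_filter.2 ⟨mem_range.2 (by omega), ?_⟩, by omega⟩
      rwa [show i - 4 + 3 + 1 = i by omega]
    have hc3 : dyadicSeq c₀ c₁ c₂ f E 3 = skipSucc (f 3) (f 5) :=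
      dyadicSeq_pred_pow _ _ _ _ _ le_rfl ⟨2, rfl⟩
    have hd0 : dyadicSeq c₀ c₁ c₂ f E 0 = c₀ := by simp [dyadicSeq]
    have hd1 : dyadicSeq c₀ c₁ c₂ f E 1 = c₁ := by simp [dyadicSeq]
    have hd2 : dyadicSeq c₀ c₁ c₂ f E 2 = c₂ := by simp [dyadicSeq]
    rw [show l + 4 - 1 = l + 1 + 1 + 1 by omega, sum_range_succ', sum_range_succ',
      sum_range_succ', sum_congr rfl fun i _ => dyadicSeq_ascent c₀ c₁ c₂ f E hE
        (show 3 ≤ i + 1 + 1 + 1 by omega), sum_add_distrib]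
    simp only [zero_add, Nat.reduceAdd, hd0, hd1, hd2, hc3]
    rw [← hTa]
    congr 1
    have hK' : K = ∑ i ∈ range l, (i + 1 + 1 + 1 + 1) *
      (if dyadicSeq 0 0 0 f ∅ (i + 1 + 1 + 1) ≤ dyadicSeq 0 0 0 f ∅ (i + 1 + 1 + 1 + 1)
        then 1 else 0) := rfl
    have hEsum' : ∑ i ∈ range l, (if i + 1 + 1 + 1 + 1 ∈ E then i + 1 + 1 + 1 + 1 else 0)
      = 4 * (T / 4) := hEsum
    rw [← hK', hEsum']
    omega
  · rw [← hzb, ← Nat.mod_add_mod z, ← hcz, Nat.mod_mod, Nat.mod_add_mod,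
      show l + 4 = l + 1 + 1 + 1 + 1 by omega, sum_range_succ', sum_range_succ', sum_range_succ']
    have hY' : ∑ i ∈ range (l + 1), dyadicSeq c₀ c₁ c₂ f E (i + 1 + 1 + 1) = Y :=
      sum_congr rfl fun i _ => by simp [dyadicSeq]
    rw [hY']
    congr 1
    simp [dyadicSeq]
    ring

theorem eq_of_dyadicSeq_eq {n c₀ c₁ c₂ d₀ d₁ d₂ : ℕ} {f g : ℕ → ℕ} {E F : Finset ℕ}
    (hS : ∀ i < n, dyadicSeq c₀ c₁ c₂ f E i = dyadicSeq d₀ d₁ d₂ g F i)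
    (hfg : ∀ i < n, (i < 4 ∨ ∃ j, i = 2 ^ j) → f i = g i) (hout : ∀ i, n ≤ i → f i = g i) :
    f = g := by
  have key : ∀ i, (¬ ∃ j, i + 1 = 2 ^ j) → f i = g i := by
    intro i hp
    by_cases hi : i < n
    · by_cases h : i < 4 ∨ ∃ j, i = 2 ^ j
      · exact hfg i hi h
      · push Not at h
        have := hS i hi
        rwa [dyadicSeq_of_not_pow _ _ _ _ _ (by omega) (by push Not; exact h.2) hp,
          dyadicSeq_of_not_pow _ _ _ _ _ (by omega) (by push Not; exact h.2) hp] at this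
    · exact hout i (by omega)
  funext i
  by_cases hi : i < n
  swap
  · exact hout i (by omega)
  by_cases hi4 : i < 4
  · exact hfg i hi (.inl hi4)
  by_cases hp : ∃ j, i + 1 = 2 ^ j
  · have h := hS i hi
    have h4 := four_dvd_of_eq_two_pow (by omega) hp
    rw [dyadicSeq_pred_pow _ _ _ _ _ (by omega) hp, dyadicSeq_pred_pow _ _ _ _ _ (by omega) hp,
      key (i + 2) fun h' => by
        have := four_dvd_of_eq_two_pow (by omega) h'
        omega] at h
    exact skipSucc_injective _ h
  · exact key i hp

theorem exists_mem_VTq_dyadicSeq {n q a b : ℕ} (hq : 4 ≤ q) (hn : 6 ≤ n) (ha : a < n) (hb : b < q)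
    (f : ℕ → ℕ) (hf : ∀ i < n, f i < q)
    (hf' : ∀ i < n, 3 ≤ i → (∃ j, i + 1 = 2 ^ j) → f i + 2 < q) (hf3 : f 3 + 3 = q) :
    ∃ S ∈ VTq n q a b, ∃ c₀ c₁ c₂ E, ∀ i : Fin n, (S i).val = dyadicSeq c₀ c₁ c₂ f E i := by
  obtain ⟨c₀, c₁, c₂, E, hlt, hsyn, hsum⟩ := exists_dyadicSeq hq hn ha hb f hf hf' hf3
  refine ⟨fun i => ⟨dyadicSeq c₀ c₁ c₂ f E i, hlt i i.2⟩, ?_, c₀, c₁, c₂, E, fun _ => rfl⟩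
  refine mem_filter.2 ⟨mem_univ _, ?_, ?_⟩
  · rw [← hsyn, ← Fin.sum_univ_eq_sum_range (fun i => (i + 1) *
      (if dyadicSeq c₀ c₁ c₂ f E i ≤ dyadicSeq c₀ c₁ c₂ f E (i + 1) then 1 else 0))]
    simp only [qsyn, Fin.mk_le_mk]
  · rw [← hsum, ← Fin.sum_univ_eq_sum_range (dyadicSeq c₀ c₁ c₂ f E), qsum]

theorem vt_qary_encoder_card_lower_bound (m q n t k : ℕ)
    (hm : 2 ≤ m) (hq : q = 2 ^ m) (hn : 6 ≤ n)
    (ht : t = Nat.clog 2 n)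
    (hk : k = n * m - t * (m + 1) - 2 * (m - 1))
    (a b : ℕ) (ha : a ≤ n - 1) (hb : b < q) :
    2 ^ k ≤ (VTq n q a b).card := by
  have hnt : n ≤ 2 ^ t := ht ▸ Nat.le_pow_clog one_lt_two n
  have ht2 : 2 ≤ t := by
    by_contra! h
    interval_cases t <;> omega
  have hq4 : 4 ≤ q := hq ▸ Nat.pow_le_pow_right (n := 2) two_pos hm
  set D : Finset (Fin n → ℕ) := Fintype.piFinset fun i : Fin n =>
    Ico (if i.val = 3 then q - 3 else 0) ((if i.val = 3 then q - 3 else 0) +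
      2 ^ (m - bitLoss m i)) with hD
  let ext (f : Fin n → ℕ) (i : ℕ) : ℕ := if h : i < n then f ⟨i, h⟩ else 0
  have hext : ∀ f ∈ D, ∀ i < n, (if i = 3 then q - 3 else 0) ≤ ext f i ∧
      ext f i < (if i = 3 then q - 3 else 0) + 2 ^ (m - bitLoss m i) := by
    intro f hf i hi
    simpa [ext, hi] using Fintype.mem_piFinset.1 hf ⟨i, hi⟩
  have hzero : ∀ i, (i < 4 ∨ ∃ j, i = 2 ^ j) → m - bitLoss m i = 0 := by
    intro i h
    by_cases hi : i < 4
    · simp only [bitLoss, hi, if_true]; omega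
    · have : 4 ≤ i ∧ ∃ j, i = 2 ^ j := ⟨by omega, h.resolve_left hi⟩
      simp only [bitLoss, if_pos this]; omega
  have hconst : ∀ f ∈ D, ∀ i < n, (i < 4 ∨ ∃ j, i = 2 ^ j) →
      ext f i = if i = 3 then q - 3 else 0 := by
    intro f hf i hi h
    have := hext f hf i hi
    rw [hzero i h, pow_zero] at this
    omega
  have hcard : 2 ^ k ≤ #D := by
    rw [hD, Fintype.card_piFinset]
    simp only [Nat.card_Ico, Nat.add_sub_cancel_left]
    rw [Fin.prod_univ_eq_prod_range (fun i => 2 ^ (m - bitLoss m i)), prod_pow_eq_pow_sum]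
    refine Nat.pow_le_pow_right two_pos ?_
    have h₁ := sum_bitLoss_le ht2 hnt hm
    have h₂ : n * m ≤ ∑ i ∈ range n, (m - bitLoss m i) + ∑ i ∈ range n, bitLoss m i := by
      rw [← sum_add_distrib]
      calc n * m = ∑ i ∈ range n, m := by simp
        _ ≤ _ := sum_le_sum fun i _ => by omega
    omega
  refine hcard.trans ?_
  have hex : ∀ f ∈ D, ∃ S ∈ VTq n q a b, ∃ c₀ c₁ c₂ E, ∀ i : Fin n,
      (S i).val = dyadicSeq c₀ c₁ c₂ (ext f) E i := by
    intro f hf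
    have h3 : ext f 3 + 3 = q := by
      rw [hconst f hf 3 (by omega) (by omega), if_pos rfl]; omega
    refine exists_mem_VTq_dyadicSeq hq4 hn (by omega) hb _ (fun i hi => ?_)
      (fun i hi hi3 hp => ?_) h3
    · by_cases h : i = 3
      · subst h; omega
      · have := (hext f hf i hi).2
        rw [if_neg h, zero_add] at this
        exact this.trans_le (hq ▸ Nat.pow_le_pow_right two_pos (Nat.sub_le _ _))
    · by_cases h : i = 3
      · subst h; omega
      · have hlt := (hext f hf i hi).2
        rw [if_neg h, zero_add] at hlt
        have hl : m - bitLoss m i ≤ m - 1 := by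
          have : 4 ≤ i ∧ ∃ j, i + 1 = 2 ^ j := ⟨by omega, hp⟩
          simp only [bitLoss, if_pos this]; omega
        have hlt' := hlt.trans_le (Nat.pow_le_pow_right two_pos hl)
        have hq2 : q = 2 * 2 ^ (m - 1) := by
          rw [hq, ← pow_succ', Nat.sub_add_cancel (by omega)]
        omega
  have : Nonempty (Fin q) := ⟨⟨b, hb⟩⟩
  choose! enc henc c₀ c₁ c₂ E hval using hex
  refine card_le_card_of_injOn enc henc fun f hf g hg hfg => ?_
  have hS : ∀ i < n, dyadicSeq (c₀ f) (c₁ f) (c₂ f) (ext f) (E f) i =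
      dyadicSeq (c₀ g) (c₁ g) (c₂ g) (ext g) (E g) i := fun i hi => by
    rw [← hval f hf ⟨i, hi⟩, ← hval g hg ⟨i, hi⟩, hfg]
  have : ext f = ext g := by
    refine eq_of_dyadicSeq_eq hS (fun i hi h => ?_) (fun i hi => ?_)
    · rw [hconst f hf i hi h, hconst g hg i hi h]
    · simp [ext, hi.not_gt]
  funext i
  simpa [ext] using congrFun this i
end
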